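/- Suppose condition (C2) holds. Then there exists a constant B > 0 such that for every λ > 0 the self-similar profile f_λ satisfies lim_{r→∞} r^{γ} ( (r²/C_*)^{1/(1-m)} f_λ(r) − 1 ) = + B λ^{−γ}, where γ = γ_1(m,β); equivalently, f_λ(r) = (C_*/r²)^{1/(1-m)} { 1 + B λ^{−γ} r^{−γ} + o(r^{−γ}) } as r → ∞. -/

import Mathlib

open Real Filter MeasureTheory Set Topology

noncomputable section

def Cstar (n : ℕ) (m : ℝ) : ℝ := 2 * m * ((n : ℝ) - 2 - n * m) / (1 - m)

def beta1 (n : ℕ) (m : ℝ) : ℝ := 1 / ((n : ℝ) - 2 - n * m)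

def betaE (n : ℕ) (m : ℝ) : ℝ := m / ((n : ℝ) - 2 - n * m)

def beta2 (n : ℕ) (m : ℝ) : ℝ :=
  Real.sqrt (2 * (1 - m) / ((n : ℝ) - 2 - n * m)) +
    (((n : ℝ) + 2) * m - ((n : ℝ) - 2)) / (2 * ((n : ℝ) - 2 - n * m))

def beta0 (n : ℕ) (m : ℝ) : ℝ := max (beta2 n m) (betaE n m)

def A0 (n : ℕ) (m β : ℝ) : ℝ :=
  (n : ℝ) - 2 - ((n : ℝ) + 2) * m + 2 * β * ((n : ℝ) - 2 - n * m)

def gamma1 (n : ℕ) (m β : ℝ) : ℝ :=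
  (A0 n m β - Real.sqrt ((A0 n m β) ^ 2 - 8 * ((n : ℝ) - 2 - n * m) * (1 - m))) / (2 * (1 - m))

def gamma2 (n : ℕ) (m β : ℝ) : ℝ :=
  (A0 n m β + Real.sqrt ((A0 n m β) ^ 2 - 8 * ((n : ℝ) - 2 - n * m) * (1 - m))) / (2 * (1 - m))

def Acoef1 (n : ℕ) (m β : ℝ) : ℝ := 1 / (1 - m) - β * gamma1 n m β

def Acoef2 (n : ℕ) (m β : ℝ) : ℝ := 1 / (1 - m) - β * gamma2 n m β

/-- Condition (C1). -/
def CondC1 (n : ℕ) (m β : ℝ) : Prop :=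
  beta1 n m < β ∨
    (4 < n ∧ 0 < m ∧ m < ((n : ℝ) - 4) / ((n : ℝ) - 2) ∧ beta0 n m < β ∧ β ≤ beta1 n m)

/-- Condition (C2). -/
def CondC2 (n : ℕ) (m β : ℝ) : Prop :=
  beta0 n m < β ∧ β < beta1 n m ∧
    (n ≤ 4 ∨ (4 < n ∧ ((n : ℝ) - 4) / ((n : ℝ) - 2) < m ∧ m < ((n : ℝ) - 2) / n))

/-- Condition (C3). -/
def CondC3 (n : ℕ) (m β : ℝ) : Prop :=
  β = beta1 n m ∧
    (n ≤ 4 ∨ (4 < n ∧ ((n : ℝ) - 4) / ((n : ℝ) - 2) < m ∧ m < ((n : ℝ) - 2) / n))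

/-- A self-similar profile `f = f_lam`. -/
structure IsProfile (n : ℕ) (m β α lam : ℝ) (f : ℝ → ℝ) : Prop where
  pos : ∀ r, 0 ≤ r → 0 < f r
  smooth : ContDiffOn ℝ 2 f (Set.Ici 0)
  ode : ∀ r, 0 < r →
    deriv (deriv (fun s => f s ^ m)) r + (((n : ℝ) - 1) / r) * deriv (fun s => f s ^ m) r +
      α * f r + β * r * deriv f r = 0
  init : f 0 = lam ^ (2 / (1 - m))
  init' : deriv f 0 = 0
  asymp : Tendsto (fun r => r ^ 2 * f r ^ (1 - m)) atTop (nhds (Cstar n m))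

/-- The Laplacian of `f : ℝ^n → ℝ`. -/
def lap (n : ℕ) (f : EuclideanSpace ℝ (Fin n) → ℝ) (x : EuclideanSpace ℝ (Fin n)) : ℝ :=
  ∑ i : Fin n,
    fderiv ℝ (fun y => fderiv ℝ f y (EuclideanSpace.single i (1 : ℝ))) x
      (EuclideanSpace.single i (1 : ℝ))

/-- The self-similar solution `U_lam(x,t) = (T-t)^α f_lam((T-t)^β |x|)`. -/
def Uself (n : ℕ) (β α T : ℝ) (f : ℝ → ℝ) (x : EuclideanSpace ℝ (Fin n)) (t : ℝ) : ℝ :=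
  (T - t) ^ α * f ((T - t) ^ β * ‖x‖)

/-- A (positive smooth) solution of the Cauchy problem `u_t = Δ(u^m)` on `ℝ^n × (0,T)` with
initial value `u0` taken in `L¹_loc`. -/
structure IsCauchySolution (n : ℕ) (m T : ℝ) (u0 : EuclideanSpace ℝ (Fin n) → ℝ)
    (u : EuclideanSpace ℝ (Fin n) → ℝ → ℝ) : Prop where
  pos : ∀ x, ∀ t ∈ Set.Ioo 0 T, 0 < u x t
  smooth : ContDiffOn ℝ (⊤ : ℕ∞) (fun p : EuclideanSpace ℝ (Fin n) × ℝ => u p.1 p.2)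
    ((Set.univ : Set (EuclideanSpace ℝ (Fin n))) ×ˢ Set.Ioo 0 T)
  pde : ∀ x, ∀ t ∈ Set.Ioo 0 T, deriv (u x) t = lap n (fun y => u y t ^ m) x
  init : ∀ K : Set (EuclideanSpace ℝ (Fin n)), IsCompact K →
    Tendsto (fun t => ∫ x in K, |u x t - u0 x|) (nhdsWithin 0 (Set.Ioi 0)) (nhds 0)

/-- The rescaled solution `ũ(y,τ)`. -/
def resc (n : ℕ) (β α T : ℝ) (u : EuclideanSpace ℝ (Fin n) → ℝ → ℝ)
    (y : EuclideanSpace ℝ (Fin n)) (τ : ℝ) : ℝ :=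
  (T * Real.exp (-τ)) ^ (-α) * u (((T * Real.exp (-τ)) ^ (-β)) • y) (T * (1 - Real.exp (-τ)))

/-- The singular profile `𝒞(y) = (C_*/|y|²)^{1/(1-m)}`. -/
def singC (n : ℕ) (m : ℝ) (y : EuclideanSpace ℝ (Fin n)) : ℝ :=
  (Cstar n m / ‖y‖ ^ 2) ^ (1 / (1 - m))

/-- The weight exponent `p₀`. -/
def pZero (n : ℕ) (m β : ℝ) : ℝ := ((1 - m) / 2) * ((n : ℝ) - 2 / (1 - m) - gamma1 n m β)

/-- The constant `a_*`. -/
def aStar (n : ℕ) (m β : ℝ) : ℝ :=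
  2 * m * pZero n m β / (Cstar n m * (1 - m)) * (gamma1 n m β + 2 * m / (1 - m))

/-- `Φ(s) = (1+w(s))^{1/m} − 1 − w(s)/m`. -/
def Phi (m : ℝ) (w : ℝ → ℝ) (s : ℝ) : ℝ := (1 + w s) ^ (1 / m) - 1 - w s / m

end

/-- The tangent line inequality for `x ↦ x ^ p`, based at `x` and evaluated at `1`. -/
theorem rpow_sub_one_le_tangent {p x : ℝ} (hp : 1 ≤ p) (hx : 0 < x) :
    x ^ p - 1 ≤ p * (x - 1) * x ^ (p - 1) := by
  have h := one_add_mul_self_le_rpow_one_add (s := x⁻¹ - 1)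
    (by have := inv_pos.2 hx; linarith) hp
  have hxp : 0 < x ^ p := rpow_pos_of_pos hx p
  rw [add_sub_cancel, inv_rpow hx.le] at h
  rw [rpow_sub_one hx.ne']
  have h2 := mul_le_mul_of_nonneg_right h hxp.le
  rw [inv_mul_cancel₀ hxp.ne'] at h2
  have : p * (x - 1) * (x ^ p / x) = x ^ p - (1 + p * (x⁻¹ - 1)) * x ^ p + (x ^ p - x ^ p) := by
    field_simp
    ring
  rw [this]; linarith

/-- A solution of the differential inequality `V' ≥ -a V` that is positive once stays positive. -/
theorem pos_of_neg_mul_le_deriv {V V' a : ℝ → ℝ} (ha : Continuous a)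
    (hV : ∀ s, HasDerivAt V (V' s) s) (hle : ∀ s, -(a s) * V s ≤ V' s) {s₀ : ℝ}
    (h₀ : 0 < V s₀) {s : ℝ} (hs : s₀ ≤ s) : 0 < V s := by
  have hΛ : ∀ t, HasDerivAt (fun t => ∫ x in s₀..t, a x) (a t) t := fun t =>
    ha.integral_hasStrictDerivAt s₀ t |>.hasDerivAt
  have hmono : Monotone fun t => V t * exp (∫ x in s₀..t, a x) := by
    refine monotone_of_hasDerivAt_nonneg (fun t => (hV t).mul (hΛ t).exp) fun t => ?_
    have := mul_nonneg (exp_pos (∫ x in s₀..t, a x)).le (sub_nonneg.2 (hle t))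
    simp only [Pi.zero_apply]
    nlinarith
  have h := hmono hs
  simp only [intervalIntegral.integral_same, exp_zero, mul_one] at h
  exact pos_of_mul_pos_left (h₀.trans_le h) (exp_pos _).le

/-- Grönwall's inequality on a half-line for a coefficient `b` with antiderivative `B`. -/
theorem le_mul_exp_of_deriv_le {Z Z' b B : ℝ → ℝ} (hZ : ∀ s, HasDerivAt Z (Z' s) s)
    (hB : ∀ s, HasDerivAt B (b s) s) {s₁ : ℝ} (hle : ∀ s ≥ s₁, Z' s ≤ b s * Z s) {s : ℝ}
    (hs : s₁ ≤ s) : Z s ≤ Z s₁ * exp (B s - B s₁) := by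
  have hd := fun t => (hZ t).mul (hB t).neg.exp
  have hanti : AntitoneOn (fun t => Z t * exp (-B t)) (Ici s₁) := by
    refine antitoneOn_of_deriv_nonpos (convex_Ici s₁)
      (fun t _ => (hd t).continuousAt.continuousWithinAt)
      (fun t _ => (hd t).differentiableAt.differentiableWithinAt) fun t ht => ?_
    rw [interior_Ici] at ht
    refine ((hd t).deriv).symm ▸ ?_
    have := mul_nonneg (sub_nonneg.2 (hle t (le_of_lt ht))) (exp_pos (-B t)).le
    simp only [Pi.neg_apply]
    linarith
  have h := mul_le_mul_of_nonneg_right (hanti self_mem_Ici hs hs) (exp_pos (B s)).le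
  simp only [mul_assoc, ← exp_add] at h
  rwa [neg_add_cancel, exp_zero, mul_one, neg_add_eq_sub] at h

/-- The profile equation in the variable `s = log r` for the normalized pressure `W`, where `P`
stands for `W'`; `W = 1` corresponds to the singular profile. -/
structure IsLogProfile (p k d δ : ℝ) (W P : ℝ → ℝ) : Prop where
  pos : ∀ s, 0 < W s
  deriv_W : ∀ s, HasDerivAt W (P s) s
  deriv_P : ∀ s, HasDerivAt P
    (-(d - k + (k - δ) * p * W s ^ (p - 1)) * P s - k * d * (W s ^ p - W s)) s

namespace IsLogProfile

variable {p k d δ γ γ' : ℝ} {W P : ℝ → ℝ}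

theorem continuous (h : IsLogProfile p k d δ W P) : Continuous W :=
  continuous_iff_continuousAt.2 fun s => (h.deriv_W s).continuousAt

theorem continuous_P (h : IsLogProfile p k d δ W P) : Continuous P :=
  continuous_iff_continuousAt.2 fun s => (h.deriv_P s).continuousAt

theorem continuous_rpow (h : IsLogProfile p k d δ W P) (q : ℝ) : Continuous fun s => W s ^ q :=
  h.continuous.rpow_const fun s => Or.inl (h.pos s).ne'

/-- The derivative of `W' + γ (W - 1)` when `γ`, `γ'` are the characteristic exponents. -/
theorem hasDerivAt_deviation (h : IsLogProfile p k d δ W P) (hk : k * (p - 1) = 2)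
    (hsum : γ + γ' = d + 2 - δ * p) (hprod : γ * γ' = 2 * d) (s : ℝ) :
    HasDerivAt (fun s => P s + γ * (W s - 1))
      (-(γ' + (k - δ) * p * (W s ^ (p - 1) - 1)) * (P s + γ * (W s - 1)) +
        (γ * ((k - δ) * p * (W s ^ (p - 1) - 1)) * (W s - 1) -
          k * d * (W s ^ p - 1 - p * (W s - 1)))) s := by
  refine ((h.deriv_P s).add (((h.deriv_W s).sub_const 1).const_mul γ)).congr_deriv ?_
  have e1 : γ' = d + 2 - δ * p - γ := by linarith
  subst e1
  linear_combination (-P s - d * (W s - 1)) * hk + (W s - 1) * hprod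

/-- The nonlinear remainder in `hasDerivAt_deviation` is nonnegative. -/
theorem remainder_nonneg (h : IsLogProfile p k d δ W P) (hp : 1 < p) (hkd : 0 ≤ k * d)
    (hγ : k * d ≤ (k - δ) * γ) (s : ℝ) :
    0 ≤ γ * ((k - δ) * p * (W s ^ (p - 1) - 1)) * (W s - 1) -
      k * d * (W s ^ p - 1 - p * (W s - 1)) := by
  have h1 := mul_le_mul_of_nonneg_left (rpow_sub_one_le_tangent hp.le (h.pos s)) hkd
  have h2 : 0 ≤ (W s ^ (p - 1) - 1) * (W s - 1) := by
    rcases le_total 1 (W s) with hW | hW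
    · exact mul_nonneg (sub_nonneg.2 (one_le_rpow hW (by linarith))) (sub_nonneg.2 hW)
    · exact mul_nonneg_of_nonpos_of_nonpos
        (sub_nonpos.2 (rpow_le_one (h.pos s).le hW (by linarith))) (sub_nonpos.2 hW)
  have h3 := mul_nonneg (mul_nonneg (sub_nonneg.2 hγ) (zero_le_one.trans hp.le)) h2
  nlinarith

theorem deviation_pos (h : IsLogProfile p k d δ W P) (hp : 1 < p) (hk : k * (p - 1) = 2)
    (hkd : 0 ≤ k * d) (hsum : γ + γ' = d + 2 - δ * p) (hprod : γ * γ' = 2 * d)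
    (hγ : k * d ≤ (k - δ) * γ) {s₀ s : ℝ} (h₀ : 0 < P s₀ + γ * (W s₀ - 1)) (hs : s₀ ≤ s) :
    0 < P s + γ * (W s - 1) :=
  pos_of_neg_mul_le_deriv (V := fun s => P s + γ * (W s - 1))
    (a := fun s => γ' + (k - δ) * p * (W s ^ (p - 1) - 1))
    (by have := h.continuous_rpow (p - 1); fun_prop)
    (h.hasDerivAt_deviation hk hsum hprod)
    (fun s => le_add_of_nonneg_right (h.remainder_nonneg hp hkd hγ s)) h₀ hs

theorem hasDerivAt_weighted (h : IsLogProfile p k d δ W P) (γ s : ℝ) :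
    HasDerivAt (fun s => (W s - 1) * exp (γ * s)) ((P s + γ * (W s - 1)) * exp (γ * s)) s := by
  refine (((h.deriv_W s).sub_const 1).mul (((hasDerivAt_id s).const_mul γ).exp)).congr_deriv ?_
  simp only [id]; ring

/-- The excess over the flow `W' = k (W - W ^ p)` of the Barenblatt profile. -/
theorem hasDerivAt_excess (h : IsLogProfile p k d δ W P) (s : ℝ) :
    HasDerivAt (fun s => (P s - k * (W s - W s ^ p)) * exp (d * s))
      (δ * p * W s ^ (p - 1) * P s * exp (d * s)) s := by
  refine (((h.deriv_P s).sub (((h.deriv_W s).sub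
    ((h.deriv_W s).rpow_const (p := p) (Or.inl (h.pos s).ne'))).const_mul k)).mul
      (((hasDerivAt_id s).const_mul d).exp)).congr_deriv ?_
  simp only [id, Pi.sub_apply]; ring

theorem excess_pos (h : IsLogProfile p k d δ W P) (hp : 0 < p) (hδ : 0 < δ)
    (hbot : Tendsto (fun s => (P s - k * (W s - W s ^ p)) * exp (d * s)) atBot (𝓝 0))
    {t : ℝ} (hP : ∀ s < t, 0 < P s) : 0 < P t - k * (W t - W t ^ p) := by
  have hmono : StrictMonoOn (fun s => (P s - k * (W s - W s ^ p)) * exp (d * s)) (Iic t) := by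
    refine strictMonoOn_of_deriv_pos (convex_Iic t)
      (fun s _ => (h.hasDerivAt_excess s).continuousAt.continuousWithinAt) fun s hs => ?_
    rw [interior_Iic] at hs
    rw [(h.hasDerivAt_excess s).deriv]
    have := rpow_pos_of_pos (h.pos s) (p - 1)
    have := hP s hs
    positivity
  have h1 : 0 ≤ (P (t - 1) - k * (W (t - 1) - W (t - 1) ^ p)) * exp (d * (t - 1)) := by
    refine le_of_tendsto hbot ?_
    filter_upwards [eventually_le_atBot (t - 1)] with s hs
    exact hmono.monotoneOn (show s ≤ t by linarith) (show t - 1 ≤ t by linarith) hs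
  have h2 := h1.trans_lt (hmono (show t - 1 ≤ t by linarith) (le_refl t) (by linarith : t - 1 < t))
  exact pos_of_mul_pos_left h2 (exp_pos _).le

/-- The profile cannot increase to `1` from below: it would then decay faster than
both characteristic exponents permit. -/
theorem not_forall_lt_one (h : IsLogProfile p k d δ W P) (hp : 1 < p) (hk : k * (p - 1) = 2)
    (hkd : 0 ≤ k * d) (hδk : δ < k) (hsum : γ + γ' = d + 2 - δ * p) (hprod : γ * γ' = 2 * d)
    (hγ : k * d ≤ (k - δ) * γ) (hlt : γ' < γ) (hγ2 : γ < 2) (hk0 : 0 < k)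
    (htop : Tendsto W atTop (𝓝 1)) (hex : ∀ s, 0 < P s - k * (W s - W s ^ p)) :
    ¬ ∀ s, W s < 1 := by
  intro hW
  obtain ⟨s₁, hs₁⟩ : ∃ s, γ < k * (p * W s ^ (p - 1) - 1) := by
    have h1 : Tendsto (fun s => k * (p * W s ^ (p - 1) - 1)) atTop
        (𝓝 (k * (p * 1 ^ (p - 1) - 1))) :=
      (((htop.rpow_const (Or.inl one_ne_zero)).const_mul p).sub_const 1).const_mul k
    rw [one_rpow, mul_one, hk] at h1
    exact (h1.eventually_const_lt hγ2).exists
  have hV₁ : 0 < P s₁ + γ * (W s₁ - 1) := by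
    have h1 := rpow_sub_one_le_tangent hp.le (h.pos s₁)
    have h2 := hex s₁
    have h3 := mul_le_mul_of_nonneg_left h1 hk0.le
    have h4 := mul_pos (sub_pos.2 hs₁) (sub_pos.2 (hW s₁))
    nlinarith
  have hV := fun s hs => h.deviation_pos hp hk hkd hsum hprod hγ (s := s) hV₁ hs
  have hmono : MonotoneOn (fun s => (P s + γ * (W s - 1)) * exp (γ' * s)) (Ici s₁) := by
    have hd := fun s => ((h.hasDerivAt_deviation hk hsum hprod s).mul
      (((hasDerivAt_id s).const_mul γ').exp))
    refine monotoneOn_of_deriv_nonneg (convex_Ici s₁)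
      (fun s _ => (hd s).continuousAt.continuousWithinAt)
      (fun s _ => (hd s).differentiableAt.differentiableWithinAt) fun s hs => ?_
    rw [interior_Ici] at hs
    refine ((hd s).deriv).symm ▸ ?_
    have h1 := h.remainder_nonneg hp hkd hγ s
    have h2 : 0 ≤ (k - δ) * p * (1 - W s ^ (p - 1)) :=
      mul_nonneg (mul_nonneg (by linarith) (by linarith))
        (sub_nonneg.2 (rpow_le_one (h.pos s).le (hW s).le (by linarith)))
    have h3 := mul_nonneg (add_nonneg (mul_nonneg h2 (hV s (le_of_lt hs)).le) h1)
      (exp_pos (γ' * s)).le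
    simp only [id]
    linarith
  set c := (P s₁ + γ * (W s₁ - 1)) * exp (γ' * s₁) * exp ((γ - γ') * s₁) with hc
  have hc0 : 0 < c := mul_pos (mul_pos hV₁ (exp_pos _)) (exp_pos _)
  have hgrow : MonotoneOn (fun s => (W s - 1) * exp (γ * s) - c * s) (Ici s₁) := by
    have hd := fun s => (h.hasDerivAt_weighted γ s).sub ((hasDerivAt_id s).const_mul c)
    refine monotoneOn_of_deriv_nonneg (convex_Ici s₁)
      (fun s _ => (hd s).continuousAt.continuousWithinAt)
      (fun s _ => (hd s).differentiableAt.differentiableWithinAt) fun s hs => ?_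
    rw [interior_Ici] at hs
    refine ((hd s).deriv).symm ▸ ?_
    have hs' : s₁ ≤ s := le_of_lt hs
    have h1 : (P s + γ * (W s - 1)) * exp (γ * s) =
        (P s + γ * (W s - 1)) * exp (γ' * s) * exp ((γ - γ') * s) := by
      rw [mul_assoc, ← exp_add]; congr 2; ring
    rw [h1, mul_one, sub_nonneg, hc]
    refine mul_le_mul (hmono self_mem_Ici hs' hs') (exp_le_exp.2 ?_) (exp_pos _).le
      (mul_pos (hV s hs') (exp_pos _)).le
    exact mul_le_mul_of_nonneg_left hs' (by linarith)
  set K := (W s₁ - 1) * exp (γ * s₁) - c * s₁ with hK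
  obtain ⟨s, hs, hsK⟩ := ((eventually_ge_atTop s₁).and (eventually_ge_atTop (-K / c))).exists
  have h1 := hgrow self_mem_Ici hs hs
  have h2 := mul_neg_of_neg_of_pos (sub_neg.2 (hW s)) (exp_pos (γ * s))
  rw [div_le_iff₀ hc0] at hsK
  simp only at h1
  linarith

/-- The profile crosses the value `1` with positive slope. -/
theorem exists_crossing (h : IsLogProfile p k d δ W P) (hp : 1 < p) (hk : k * (p - 1) = 2)
    (hkd : 0 ≤ k * d) (hδ : 0 < δ) (hδk : δ < k) (hsum : γ + γ' = d + 2 - δ * p)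
    (hprod : γ * γ' = 2 * d) (hγ : k * d ≤ (k - δ) * γ) (hlt : γ' < γ) (hγ2 : γ < 2)
    (htop : Tendsto W atTop (𝓝 1)) (hbotW : Tendsto W atBot (𝓝 0))
    (hbotP : ∀ᶠ s in atBot, 0 < P s)
    (hbot : Tendsto (fun s => (P s - k * (W s - W s ^ p)) * exp (d * s)) atBot (𝓝 0)) :
    ∃ s, W s = 1 ∧ 0 < P s := by
  have hk0 : 0 < k := hδ.trans hδk
  have hp0 : 0 < p := zero_lt_one.trans hp
  obtain ⟨b, hb⟩ := eventually_atBot.1 hbotP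
  by_cases hS : ∃ s, P s ≤ 0
  · set S := {s | P s ≤ 0} with hSdef
    have hSb : BddBelow S := ⟨b, fun s hs => le_of_not_gt fun hsb =>
      not_lt_of_ge (show P s ≤ 0 from hs) (hb s hsb.le)⟩
    have hScl : IsClosed S := isClosed_le h.continuous_P continuous_const
    have ht : P (sInf S) ≤ 0 := hScl.csInf_mem hS hSb
    set t := sInf S
    have hPt : ∀ s < t, 0 < P s := fun s hs => lt_of_not_ge fun h' =>
      not_le_of_gt hs (csInf_le hSb h')
    have hex := h.excess_pos hp0 hδ hbot hPt
    have hWt : 1 < W t := by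
      by_contra! hle
      have h1 : W t ^ p ≤ W t := by
        simpa using rpow_le_rpow_of_exponent_ge (h.pos t) hle hp.le
      nlinarith
    obtain ⟨a, ha1, hat⟩ := ((hbotW.eventually_lt_const zero_lt_one).and
      (eventually_lt_atBot t)).exists
    obtain ⟨s, hs, hs1⟩ := intermediate_value_Ioo hat.le h.continuous.continuousOn ⟨ha1, hWt⟩
    exact ⟨s, hs1, hPt s hs.2⟩
  · push Not at hS
    refine absurd (fun s => ?_) (h.not_forall_lt_one hp hk hkd hδk hsum hprod hγ hlt hγ2 hk0 htop
      fun s => h.excess_pos hp0 hδ hbot fun t _ => hS t)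
    have hmono := strictMono_of_hasDerivAt_pos h.deriv_W hS
    exact (hmono (lt_add_one s)).trans_le (hmono.monotone.ge_of_tendsto htop _)

/-- A profile staying above `1` is bounded by its slow characteristic mode. -/
theorem weighted_bddAbove (h : IsLogProfile p k d δ W P) (hp : 1 < p) (hk : k * (p - 1) = 2)
    (hkd : 0 ≤ k * d) (hδk : δ < k) (hsum : γ + γ' = d + 2 - δ * p) (hprod : γ * γ' = 2 * d)
    (hγ0 : 0 < γ) (hlt : γ < γ') (htop : Tendsto W atTop (𝓝 1))
    {s₀ : ℝ} (hW : ∀ s ≥ s₀, 1 ≤ W s) (hV : ∀ s ≥ s₀, 0 < P s + γ * (W s - 1)) :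
    ∃ M, ∀ᶠ s in atTop, (W s - 1) * exp (γ * s) ≤ M := by
  obtain ⟨K, hK0, hK⟩ : ∃ K > 0, ∀ᶠ s in atTop, W s ^ (p - 1) - 1 ≤ K * (W s - 1) := by
    obtain ⟨K, hK0, hK⟩ := ((hasDerivAt_rpow_const (x := 1) (p := p - 1)
      (Or.inl one_ne_zero)).isBigO_sub.comp_tendsto htop).exists_pos
    refine ⟨K, hK0, ?_⟩
    filter_upwards [hK.bound, eventually_ge_atTop s₀] with s hs hs₀
    simp only [Function.comp_apply, one_rpow, norm_eq_abs, abs_of_nonneg (sub_nonneg.2 (hW s hs₀))]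
      at hs
    exact (le_abs_self _).trans hs
  set ε := γ' - γ with hεdef
  have hε : 0 < ε := sub_pos.2 hlt
  set N := γ * ((k - δ) * p * K) / ε with hN
  have hN0 : 0 < N := by
    have := sub_pos.2 hδk
    have : 0 < p := zero_lt_one.trans hp
    positivity
  have hsmall : ∀ᶠ s in atTop, N * (W s - 1) ≤ γ / 2 := by
    have h1 : Tendsto (fun s => N * (W s - 1)) atTop (𝓝 (N * (1 - 1))) :=
      (htop.sub_const 1).const_mul N
    rw [sub_self, mul_zero] at h1
    exact (h1.eventually_lt_const (half_pos hγ0)).mono fun s hs => hs.le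
  obtain ⟨s₁, hs₁⟩ := eventually_atTop.1 ((hK.and hsmall).and (eventually_ge_atTop s₀))
  set Z := fun s => (P s + γ * (W s - 1)) * exp (γ * s) + ε * ((W s - 1) * exp (γ * s)) with hZ
  set Z' := fun s => (γ * ((k - δ) * p * (W s ^ (p - 1) - 1)) * (W s - 1) -
    k * d * (W s ^ p - 1 - p * (W s - 1)) -
    (k - δ) * p * (W s ^ (p - 1) - 1) * (P s + γ * (W s - 1))) * exp (γ * s) with hZ'
  have hd : ∀ s, HasDerivAt Z (Z' s) s := fun s => by
    refine (((h.hasDerivAt_deviation hk hsum hprod s).mul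
      (((hasDerivAt_id s).const_mul γ).exp)).add
        ((h.hasDerivAt_weighted γ s).const_mul ε)).congr_deriv ?_
    simp only [id, hZ', hεdef]; ring
  have hwZ : ∀ s ≥ s₁, ε * ((W s - 1) * exp (γ * s)) ≤ Z s := fun s hs =>
    le_add_of_nonneg_left (mul_pos (hV s (hs₁ s hs).2) (exp_pos _)).le
  have hZle : ∀ s ≥ s₁, Z' s ≤ N * (W s - 1) * Z s := fun s hs => by
    obtain ⟨⟨hKs, -⟩, hs₀⟩ := hs₁ s hs
    have hw : 0 ≤ W s - 1 := sub_nonneg.2 (hW s hs₀)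
    have hkp : 0 ≤ (k - δ) * p := mul_nonneg (by linarith) (by linarith)
    have h1 : 0 ≤ k * d * (W s ^ p - 1 - p * (W s - 1)) := by
      have := one_add_mul_self_le_rpow_one_add (s := W s - 1) (by linarith) hp.le
      rw [add_sub_cancel] at this
      exact mul_nonneg hkd (by linarith)
    have h2 : 0 ≤ (k - δ) * p * (W s ^ (p - 1) - 1) * (P s + γ * (W s - 1)) :=
      mul_nonneg (mul_nonneg hkp (sub_nonneg.2 (one_le_rpow (hW s hs₀) (by linarith))))
        (hV s hs₀).le
    calc Z' s ≤ (γ * ((k - δ) * p * (K * (W s - 1))) * (W s - 1)) * exp (γ * s) := by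
          refine mul_le_mul_of_nonneg_right ?_ (exp_pos _).le
          have h3 := mul_le_mul_of_nonneg_right (mul_le_mul_of_nonneg_left
            (mul_le_mul_of_nonneg_left hKs hkp) hγ0.le) hw
          linarith
      _ = N * (W s - 1) * (ε * ((W s - 1) * exp (γ * s))) := by
          rw [hN]; field_simp
      _ ≤ N * (W s - 1) * Z s :=
          mul_le_mul_of_nonneg_left (hwZ s hs) (mul_nonneg hN0.le hw)
  have hZ0 : ∀ s ≥ s₁, 0 ≤ Z s := fun s hs => le_trans
    (mul_nonneg hε.le (mul_nonneg (sub_nonneg.2 (hW s (hs₁ s hs).2)) (exp_pos _).le)) (hwZ s hs)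
  have hgrow : ∀ s ≥ s₁, Z s ≤ Z s₁ * exp (γ / 2 * s - γ / 2 * s₁) := fun s hs =>
    le_mul_exp_of_deriv_le (b := fun _ => γ / 2) (B := fun s => γ / 2 * s) hd
      (fun s => by simpa using (hasDerivAt_id s).const_mul (γ / 2))
      (fun s hs => (hZle s hs).trans
        (mul_le_mul_of_nonneg_right (hs₁ s hs).1.2 (hZ0 s hs))) hs
  set L := N * (Z s₁ * exp (-(γ / 2 * s₁)) / ε) with hL
  have hL0 : 0 ≤ L := mul_nonneg hN0.le
    (div_nonneg (mul_nonneg (hZ0 s₁ le_rfl) (exp_pos _).le) hε.le)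
  have hdecay : ∀ s ≥ s₁, N * (W s - 1) ≤ L * exp (-(γ / 2) * s) := fun s hs => by
    rw [hL, mul_assoc]
    refine mul_le_mul_of_nonneg_left ?_ hN0.le
    rw [div_mul_eq_mul_div, le_div_iff₀ hε]
    refine le_of_mul_le_mul_right ?_ (exp_pos (γ * s))
    calc (W s - 1) * ε * exp (γ * s) = ε * ((W s - 1) * exp (γ * s)) := by ring
      _ ≤ Z s₁ * exp (γ / 2 * s - γ / 2 * s₁) := (hwZ s hs).trans (hgrow s hs)
      _ = Z s₁ * exp (-(γ / 2 * s₁)) * exp (-(γ / 2) * s) * exp (γ * s) := by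
          rw [mul_assoc, mul_assoc, ← exp_add, ← exp_add]; congr 2; ring
  refine ⟨Z s₁ * exp (2 * L / γ * exp (-(γ / 2) * s₁)) / ε, ?_⟩
  filter_upwards [eventually_ge_atTop s₁] with s hs
  rw [le_div_iff₀ hε, mul_comm]
  refine (hwZ s hs).trans ((le_mul_exp_of_deriv_le (b := fun s => L * exp (-(γ / 2) * s))
    (B := fun s => -(2 * L / γ) * exp (-(γ / 2) * s)) hd (fun s => ?_)
    (fun s hs => (hZle s hs).trans (mul_le_mul_of_nonneg_right (hdecay s hs) (hZ0 s hs)))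
    hs).trans (mul_le_mul_of_nonneg_left (exp_le_exp.2 ?_) (hZ0 s₁ le_rfl)))
  · refine ((((hasDerivAt_id s).const_mul (-(γ / 2))).exp).const_mul (-(2 * L / γ))).congr_deriv ?_
    simp only [id]
    field_simp
  · have : 0 ≤ 2 * L / γ * exp (-(γ / 2) * s) := by positivity
    linarith

/-- Slow decay from above: `W - 1` is asymptotic to a positive multiple of `exp (-γ s)`, where
`γ` is the smaller characteristic exponent. -/
theorem tendsto_weighted (h : IsLogProfile p k d δ W P) (hp : 1 < p) (hk : k * (p - 1) = 2)
    (hd : 0 < d) (hδ : 0 < δ) (hδk : δ < k) (hsum : γ + γ' = d + 2 - δ * p)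
    (hprod : γ * γ' = 2 * d) (hγ : k * d ≤ (k - δ) * γ) (hlt : γ < γ') (hγ2 : γ' < 2)
    (htop : Tendsto W atTop (𝓝 1)) (hbotW : Tendsto W atBot (𝓝 0))
    (hbotP : ∀ᶠ s in atBot, 0 < P s)
    (hbot : Tendsto (fun s => (P s - k * (W s - W s ^ p)) * exp (d * s)) atBot (𝓝 0)) :
    ∃ B > 0, (∀ᶠ s in atTop, 1 < W s) ∧
      Tendsto (fun s => (W s - 1) * exp (γ * s)) atTop (𝓝 B) := by
  have hk0 : 0 < k := hδ.trans hδk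
  have hkd : 0 < k * d := mul_pos hk0 hd
  have hγ0 : 0 < γ := pos_of_mul_pos_right (hkd.trans_le hγ) (sub_pos.2 hδk).le
  obtain ⟨s₀, hs₀, hP₀⟩ := h.exists_crossing hp hk hkd.le hδ hδk (by linarith) (by linarith)
    (hγ.trans (mul_le_mul_of_nonneg_left hlt.le (sub_pos.2 hδk).le)) hlt hγ2 htop hbotW hbotP hbot
  have hV : ∀ s ≥ s₀, 0 < P s + γ * (W s - 1) := fun s hs =>
    h.deviation_pos hp hk hkd.le hsum hprod hγ (by rw [hs₀]; linarith) hs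
  have hmono : StrictMonoOn (fun s => (W s - 1) * exp (γ * s)) (Ici s₀) := by
    refine strictMonoOn_of_deriv_pos (convex_Ici s₀)
      (fun s _ => (h.hasDerivAt_weighted γ s).continuousAt.continuousWithinAt) fun s hs => ?_
    rw [interior_Ici] at hs
    rw [(h.hasDerivAt_weighted γ s).deriv]
    exact mul_pos (hV s (le_of_lt hs)) (exp_pos _)
  have hpos : ∀ s > s₀, 0 < (W s - 1) * exp (γ * s) := fun s hs => by
    simpa [hs₀] using hmono self_mem_Ici (le_of_lt hs) hs
  have hW : ∀ s > s₀, 1 < W s := fun s hs =>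
    sub_pos.1 (pos_of_mul_pos_left (hpos s hs) (exp_pos _).le)
  obtain ⟨M, hM⟩ := h.weighted_bddAbove hp hk hkd.le hδk hsum hprod hγ0 hlt htop
    (fun s hs => hs.eq_or_lt.elim (fun e => (e ▸ hs₀).ge) fun hlt => (hW s hlt).le) hV
  obtain ⟨s₂, hs₂⟩ := eventually_atTop.1 hM
  set y := fun s => (W (max s (s₀ + 1)) - 1) * exp (γ * max s (s₀ + 1)) with hy
  have hymono : Monotone y := fun a b hab => hmono.monotoneOn
    (show s₀ ≤ max a (s₀ + 1) from le_max_of_le_right (by linarith))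
    (show s₀ ≤ max b (s₀ + 1) from le_max_of_le_right (by linarith)) (max_le_max_right _ hab)
  have hbdd : BddAbove (range y) := by
    refine ⟨M, ?_⟩
    rintro _ ⟨s, rfl⟩
    exact (hymono (le_max_left s s₂)).trans
      (hs₂ _ ((le_max_right s s₂).trans (le_max_left _ _)))
  refine ⟨⨆ s, y s, (hpos (s₀ + 1) (by linarith)).trans_le ?_, ?_, ?_⟩
  · simpa [hy] using le_ciSup hbdd (s₀ + 1)
  · filter_upwards [eventually_gt_atTop s₀] with s hs using hW s hs
  · refine (tendsto_atTop_ciSup hymono hbdd).congr' ?_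
    filter_upwards [eventually_ge_atTop (s₀ + 1)] with s hs
    simp only [hy, max_eq_left hs]

end IsLogProfile

theorem exponent_bounds {n : ℕ} {m β : ℝ} (hn : 3 ≤ n) (hm0 : 0 < m) (hm1 : m < 1)
    (hD : 0 < (n : ℝ) - 2 - n * m) (hC2 : CondC2 n m β) :
    0 < β ∧ β * ((n : ℝ) - 2 - n * m) < 1 ∧ gamma1 n m β < gamma2 n m β ∧
      gamma1 n m β + gamma2 n m β = A0 n m β / (1 - m) ∧
      gamma1 n m β * gamma2 n m β = 2 * (((n : ℝ) - 2 - n * m) / (1 - m)) ∧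
      gamma2 n m β < 2 ∧ 1 / (1 - m) ≤ β * gamma1 n m β := by
  obtain ⟨hβ0, hβ1, hC⟩ := hC2
  have hβe : betaE n m < β := (le_max_right _ _).trans_lt hβ0
  have hβ2 : beta2 n m < β := (le_max_left _ _).trans_lt hβ0
  have hD2 : (n : ℝ) - 2 - n * m < 2 * (1 - m) := by
    have hn' : (3 : ℝ) ≤ n := by exact_mod_cast hn
    rcases hC with h4 | ⟨h4, hm, -⟩
    · have : (n : ℝ) ≤ 4 := by exact_mod_cast h4
      nlinarith
    · rw [div_lt_iff₀ (by linarith)] at hm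
      linarith
  unfold beta1 at hβ1
  unfold betaE at hβe
  unfold beta2 at hβ2
  rw [lt_div_iff₀ hD] at hβ1
  have hA : A0 n m β = (n : ℝ) - 2 - n * m - 2 * m + 2 * (β * ((n : ℝ) - 2 - n * m)) := by
    unfold A0; ring
  have hnum : ((n : ℝ) + 2) * m - ((n : ℝ) - 2) = 2 * m - ((n : ℝ) - 2 - n * m) := by ring
  rw [hnum] at hβ2
  unfold gamma1 gamma2
  generalize (n : ℝ) - 2 - n * m = D at *
  generalize A0 n m β = A at *
  have hm : 0 < 1 - m := sub_pos.2 hm1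
  have hβ : 0 < β := (div_pos hm0 hD).trans hβe
  have hb : 0 < β * D := mul_pos hβ hD
  set t := √(2 * (1 - m) * D) with ht
  have ht2 : t ^ 2 = 2 * (1 - m) * D := sq_sqrt (by positivity)
  have ht0 : 0 < t := sqrt_pos.2 (by positivity)
  have hβt : t + m - D / 2 < β * D := by
    have h1 : √(2 * (1 - m) / D) = t / D := by
      rw [ht, show 2 * (1 - m) / D = 2 * (1 - m) * D / D ^ 2 by field_simp,
        sqrt_div (by positivity), sqrt_sq hD.le]
    rw [h1] at hβ2
    have h2 := mul_lt_mul_of_pos_right hβ2 hD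
    have h3 : (t / D + (2 * m - D) / (2 * D)) * D = t + m - D / 2 := by
      field_simp
      ring
    linarith
  have hAt : 2 * t < A := by linarith
  have hdisc : 0 < A ^ 2 - 8 * D * (1 - m) := by nlinarith
  set S := √(A ^ 2 - 8 * D * (1 - m)) with hS
  have hS0 : 0 < S := sqrt_pos.2 hdisc
  have hS2 : S ^ 2 = A ^ 2 - 8 * D * (1 - m) := sq_sqrt hdisc.le
  have hbA : 2 * D ≤ β * D * A := by
    have hDt : D < t := by
      refine lt_of_pow_lt_pow_left₀ 2 ht0.le ?_
      rw [ht2]; nlinarith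
    have h1 : D ≤ (t + m - D / 2) * t := by
      have h2 : 2 * D * ((t + m - D / 2) * t - D) = (t - D) * (2 * m * D + D * t) := by
        linear_combination D * ht2
      have h3 : 0 < (t - D) * (2 * m * D + D * t) := mul_pos (sub_pos.2 hDt) (by positivity)
      rw [← h2] at h3
      linarith [pos_of_mul_pos_right h3 (by positivity)]
    nlinarith
  refine ⟨hβ, hβ1, ?_, ?_, ?_, ?_, ?_⟩
  · gcongr
    linarith
  · field_simp
    ring
  · field_simp
    linear_combination (-1) * hS2
  · rw [div_lt_iff₀ (by positivity)]
    have h1 : S < 4 * (1 - m) - A := by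
      refine lt_of_pow_lt_pow_left₀ 2 (by linarith) ?_
      rw [hS2]; nlinarith
    linarith
  · have h1 : β * D * S ≤ β * D * A - 2 * D := by
      refine le_of_sq_le_sq ?_ (by linarith)
      rw [mul_pow, hS2, hA]
      have h2 : 0 ≤ 4 * D * ((1 - β * D) * (D + 2 * m * (β * D))) := by
        have := sub_pos.2 hβ1
        positivity
      linarith
    rw [div_le_iff₀ hm]
    refine le_of_mul_le_mul_right ?_ hD
    have h2 : β * ((A - S) / (2 * (1 - m))) * (1 - m) * D = (β * D * A - β * D * S) / 2 := by
      field_simp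
    rw [h2]
    linarith

/-- The pressure `f ^ m`, normalized by the singular profile, as a function of `s = log r`. -/
noncomputable def logPressure (m C : ℝ) (f : ℝ → ℝ) (s : ℝ) : ℝ :=
  C ^ (-(m / (1 - m))) * exp (2 * m / (1 - m) * s) * f (exp s) ^ m

/-- The derivative of `logPressure`. -/
noncomputable def logPressureDeriv (m C : ℝ) (f : ℝ → ℝ) (s : ℝ) : ℝ :=
  C ^ (-(m / (1 - m))) * exp (2 * m / (1 - m) * s) *
    (2 * m / (1 - m) * f (exp s) ^ m + exp s * deriv (fun r => f r ^ m) (exp s))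

theorem singular_factor {m C : ℝ} (hm1 : m < 1) (hC : 0 < C) (s : ℝ) :
    (exp s ^ 2 / C) ^ (1 / (1 - m)) =
      C ^ (-(m / (1 - m))) * exp (2 * m / (1 - m) * s) * (exp s ^ 2 / C) := by
  have hm : 1 - m ≠ 0 := (sub_pos.2 hm1).ne'
  rw [div_rpow (by positivity) hC.le, ← rpow_natCast, ← rpow_mul (exp_pos s).le, ← exp_mul,
    ← exp_mul, show -(m / (1 - m)) = 1 - 1 / (1 - m) by field_simp; ring, rpow_sub hC, rpow_one,
    show s * (((2 : ℕ) : ℝ) * (1 / (1 - m))) = 2 * m / (1 - m) * s + s * ((2 : ℕ) : ℝ) by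
      push_cast; field_simp; ring, exp_add]
  field_simp

theorem logPressure_rpow {m C : ℝ} (hm0 : 0 < m) (hm1 : m < 1) (hC : 0 < C) {f : ℝ → ℝ} {s : ℝ}
    (hf : 0 < f (exp s)) :
    logPressure m C f s ^ (1 / m) = (exp s ^ 2 / C) ^ (1 / (1 - m)) * f (exp s) := by
  have hm : 1 - m ≠ 0 := (sub_pos.2 hm1).ne'
  unfold logPressure
  rw [mul_rpow (by positivity) (by positivity), mul_rpow (by positivity) (by positivity),
    ← rpow_mul hf.le, mul_one_div_cancel hm0.ne', rpow_one, ← rpow_mul hC.le, ← exp_mul,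
    div_rpow (by positivity) hC.le, ← rpow_natCast, ← rpow_mul (exp_pos s).le, ← exp_mul,
    show -(m / (1 - m)) * (1 / m) = -(1 / (1 - m)) by field_simp, rpow_neg hC.le,
    show 2 * m / (1 - m) * s * (1 / m) = s * (((2 : ℕ) : ℝ) * (1 / (1 - m))) by
      push_cast; field_simp]
  ring

namespace IsProfile

variable {n : ℕ} {m β α lam : ℝ} {f : ℝ → ℝ}

theorem contDiffAt (hf : IsProfile n m β α lam f) {r : ℝ} (hr : 0 < r) : ContDiffAt ℝ 2 f r :=
  hf.smooth.contDiffAt (Ici_mem_nhds hr)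

theorem hasDerivAt (hf : IsProfile n m β α lam f) {r : ℝ} (hr : 0 < r) :
    HasDerivAt f (deriv f r) r :=
  ((hf.contDiffAt hr).differentiableAt (by norm_num)).hasDerivAt

theorem hasDerivAt_rpow (hf : IsProfile n m β α lam f) {r : ℝ} (hr : 0 < r) :
    HasDerivAt (fun s => f s ^ m) (deriv f r * m * f r ^ (m - 1)) r :=
  (hf.hasDerivAt hr).rpow_const (Or.inl (hf.pos r hr.le).ne')

theorem hasDerivAt_deriv_rpow (hf : IsProfile n m β α lam f) {r : ℝ} (hr : 0 < r) :
    HasDerivAt (deriv fun s => f s ^ m) (deriv (deriv fun s => f s ^ m) r) r := by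
  have h : ContDiffAt ℝ 2 (fun s => f s ^ m) r :=
    (hf.contDiffAt hr).rpow_const_of_ne (hf.pos r hr.le).ne'
  exact ((h.derivWithin (m := 1) (by norm_num)).differentiableAt (by norm_num)).hasDerivAt

theorem isLogProfile (hf : IsProfile n m β α lam f) (hm0 : 0 < m) (hm1 : m < 1)
    (hα : α = (2 * β + 1) / (1 - m)) (hC : 0 < Cstar n m) :
    IsLogProfile (1 / m) (2 * m / (1 - m)) (((n : ℝ) - 2 - n * m) / (1 - m))
      (2 * m / (1 - m) - Cstar n m * β) (logPressure m (Cstar n m) f)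
      (logPressureDeriv m (Cstar n m) f) := by
  have hm : 1 - m ≠ 0 := (sub_pos.2 hm1).ne'
  have hfpos : ∀ s, 0 < f (exp s) := fun s => hf.pos _ (exp_pos s).le
  have hpos : ∀ s, 0 < logPressure m (Cstar n m) f s := fun s => by
    have := hfpos s
    unfold logPressure; positivity
  have hg : ∀ s, HasDerivAt (fun s => f (exp s) ^ m)
      (deriv (fun r => f r ^ m) (exp s) * exp s) s := fun s =>
    (hf.hasDerivAt_rpow (exp_pos s)).differentiableAt.hasDerivAt.comp s (Real.hasDerivAt_exp s)
  have hg' : ∀ s, HasDerivAt (fun s => deriv (fun r => f r ^ m) (exp s))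
      (deriv (deriv fun r => f r ^ m) (exp s) * exp s) s := fun s =>
    (hf.hasDerivAt_deriv_rpow (exp_pos s)).comp s (Real.hasDerivAt_exp s)
  have he : ∀ s, HasDerivAt (fun s => Cstar n m ^ (-(m / (1 - m))) * exp (2 * m / (1 - m) * s))
      (Cstar n m ^ (-(m / (1 - m))) * exp (2 * m / (1 - m) * s) * (2 * m / (1 - m))) s := fun s => by
    refine ((((hasDerivAt_id s).const_mul (2 * m / (1 - m))).exp).const_mul _).congr_deriv ?_
    simp only [id]; ring
  refine ⟨hpos, fun s => ((he s).mul (hg s)).congr_deriv ?_, fun s =>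
    ((he s).mul (((hg s).const_mul (2 * m / (1 - m))).add
      ((Real.hasDerivAt_exp s).mul (hg' s)))).congr_deriv ?_⟩
  · unfold logPressureDeriv; ring
  · have hode := hf.ode (exp s) (exp_pos s)
    have hWp := logPressure_rpow hm0 hm1 hC (hfpos s)
    rw [singular_factor hm1 hC] at hWp
    have hg1 : deriv (fun r => f r ^ m) (exp s) * f (exp s) = m * deriv f (exp s) * f (exp s) ^ m := by
      rw [(hf.hasDerivAt_rpow (exp_pos s)).deriv, rpow_sub_one (hfpos s).ne']
      field_simp [(hfpos s).ne']
    rw [rpow_sub_one (hpos s).ne', hWp]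
    unfold logPressure logPressureDeriv
    have hgpos : 0 < f (exp s) ^ m := rpow_pos_of_pos (hfpos s) m
    have hκ : 0 < Cstar n m ^ (-(m / (1 - m))) := rpow_pos_of_pos hC _
    have heq : deriv (deriv fun r => f r ^ m) (exp s) = -(((n : ℝ) - 1) / exp s *
      deriv (fun s => f s ^ m) (exp s) + α * f (exp s) + β * exp s * deriv f (exp s)) := by linarith
    have hg2 : deriv f (exp s) = deriv (fun r => f r ^ m) (exp s) * f (exp s) /
        (m * f (exp s) ^ m) := by
      rw [hg1]; field_simp
    simp only [Pi.mul_apply, Pi.add_apply] at *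
    rw [heq, hg2, hα]
    have hCe : Cstar n m = 2 * m * ((n : ℝ) - 2 - n * m) / (1 - m) := rfl
    have hD : (n : ℝ) - 2 - n * m = Cstar n m * (1 - m) / (2 * m) := by rw [hCe]; field_simp
    have hn : (n : ℝ) = Cstar n m / (2 * m) + 2 / (1 - m) := by
      field_simp
      rw [hCe]; field_simp; ring
    rw [hD, hn]
    have hE := exp_pos s
    have hE2 := exp_pos (2 * m / (1 - m) * s)
    generalize f (exp s) ^ m = g at *
    generalize deriv (fun r => f r ^ m) (exp s) = g1 at *
    generalize exp (2 * m / (1 - m) * s) = E2 at *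
    generalize Cstar n m ^ (-(m / (1 - m))) = κ at *
    generalize Cstar n m = C at *
    generalize exp s = E at *
    field_simp
    ring

theorem tendsto_exp_atBot (hf : IsProfile n m β α lam f) :
    Tendsto (fun s => f (exp s)) atBot (𝓝 (f 0)) :=
  (hf.smooth.continuousOn 0 self_mem_Ici).tendsto.comp
    (tendsto_nhdsWithin_iff.2 ⟨Real.tendsto_exp_atBot, .of_forall fun s => (exp_pos s).le⟩)

theorem tendsto_mul_deriv_rpow (hf : IsProfile n m β α lam f) :
    Tendsto (fun s => exp s * deriv (fun r => f r ^ m) (exp s)) atBot (𝓝 0) := by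
  have h1 : Tendsto (fun s => derivWithin f (Ici 0) (exp s)) atBot
      (𝓝 (derivWithin f (Ici 0) 0)) :=
    (hf.smooth.continuousOn_derivWithin (uniqueDiffOn_Ici 0) (by norm_num) 0
      self_mem_Ici).tendsto.comp
    (tendsto_nhdsWithin_iff.2 ⟨Real.tendsto_exp_atBot, .of_forall fun s => (exp_pos s).le⟩)
  have h2 := Real.tendsto_exp_atBot.mul ((h1.mul_const m).mul
    (hf.tendsto_exp_atBot.rpow_const (p := m - 1) (Or.inl (hf.pos 0 le_rfl).ne')))
  rw [zero_mul] at h2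
  refine h2.congr fun s => ?_
  rw [(hf.hasDerivAt_rpow (exp_pos s)).deriv, derivWithin_of_mem_nhds (Ici_mem_nhds (exp_pos s))]

theorem tendsto_logPressure_atTop (hf : IsProfile n m β α lam f) (hm0 : 0 < m) (hm1 : m < 1)
    (hC : 0 < Cstar n m) : Tendsto (logPressure m (Cstar n m) f) atTop (𝓝 1) := by
  have hm : 0 < 1 - m := sub_pos.2 hm1
  have h1 := ((hf.asymp.comp tendsto_exp_atTop).div_const (Cstar n m)).rpow_const
    (p := m / (1 - m)) (Or.inr (by positivity))
  rw [div_self hC.ne', one_rpow] at h1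
  refine h1.congr fun s => ?_
  have hfs := hf.pos _ (exp_pos s).le
  simp only [Function.comp_apply, logPressure]
  rw [div_rpow (by positivity) hC.le, mul_rpow (by positivity) (by positivity),
    ← rpow_mul hfs.le, ← rpow_natCast, ← rpow_mul (exp_pos s).le, ← exp_mul, rpow_neg hC.le,
    mul_div_cancel₀ _ hm.ne', show s * (((2 : ℕ) : ℝ) * (m / (1 - m))) = 2 * m / (1 - m) * s by
      push_cast; ring]
  ring

theorem tendsto_logPressure_atBot (hf : IsProfile n m β α lam f) (hm0 : 0 < m) (hm1 : m < 1)
    (C : ℝ) : Tendsto (logPressure m C f) atBot (𝓝 0) := by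
  have hk : 0 < 2 * m / (1 - m) := div_pos (by linarith) (sub_pos.2 hm1)
  have h1 := ((Real.tendsto_exp_atBot.comp (tendsto_id.const_mul_atBot hk)).const_mul
    (C ^ (-(m / (1 - m))))).mul (hf.tendsto_exp_atBot.rpow_const (p := m) (Or.inr hm0.le))
  rw [mul_zero, zero_mul] at h1
  exact h1

theorem tendsto_logPressureDeriv_factor (hf : IsProfile n m β α lam f) (hm0 : 0 < m) :
    Tendsto (fun s => 2 * m / (1 - m) * f (exp s) ^ m + exp s * deriv (fun r => f r ^ m) (exp s))
      atBot (𝓝 (2 * m / (1 - m) * f 0 ^ m)) := by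
  simpa using ((hf.tendsto_exp_atBot.rpow_const (p := m) (Or.inr hm0.le)).const_mul
    (2 * m / (1 - m))).add hf.tendsto_mul_deriv_rpow

theorem logPressureDeriv_pos_atBot (hf : IsProfile n m β α lam f) (hm0 : 0 < m) (hm1 : m < 1)
    {C : ℝ} (hC : 0 < C) : ∀ᶠ s in atBot, 0 < logPressureDeriv m C f s := by
  have hk : 0 < 2 * m / (1 - m) := div_pos (by linarith) (sub_pos.2 hm1)
  filter_upwards [(hf.tendsto_logPressureDeriv_factor hm0).eventually_const_lt
    (mul_pos hk (rpow_pos_of_pos (hf.pos 0 le_rfl) m))] with s hs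
  exact mul_pos (mul_pos (rpow_pos_of_pos hC _) (exp_pos _)) hs

theorem tendsto_logPressureDeriv_atBot (hf : IsProfile n m β α lam f) (hm0 : 0 < m) (hm1 : m < 1)
    (C : ℝ) : Tendsto (logPressureDeriv m C f) atBot (𝓝 0) := by
  have hk : 0 < 2 * m / (1 - m) := div_pos (by linarith) (sub_pos.2 hm1)
  have h1 := ((Real.tendsto_exp_atBot.comp (tendsto_id.const_mul_atBot hk)).const_mul
    (C ^ (-(m / (1 - m))))).mul (hf.tendsto_logPressureDeriv_factor hm0)
  rw [mul_zero, zero_mul] at h1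
  exact h1

theorem exists_tendsto_weighted (hf : IsProfile n m β α lam f) (hn : 3 ≤ n) (hm0 : 0 < m)
    (hm1 : m < ((n : ℝ) - 2) / n) (hα : α = (2 * β + 1) / (1 - m)) (hC2 : CondC2 n m β) :
    ∃ B > 0, Tendsto
      (fun r : ℝ => r ^ gamma1 n m β * ((r ^ 2 / Cstar n m) ^ (1 / (1 - m)) * f r - 1))
      atTop (𝓝 B) := by
  have hn0 : (0 : ℝ) < n := by exact_mod_cast (by lia : 0 < n)
  rw [lt_div_iff₀ hn0] at hm1
  have hD : 0 < (n : ℝ) - 2 - n * m := by linarith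
  have hm1 : m < 1 := by nlinarith
  have hm : 0 < 1 - m := sub_pos.2 hm1
  obtain ⟨hβ, hβ1, hlt, hsum, hprod, hγ2, hγ⟩ := exponent_bounds hn hm0 hm1 hD hC2
  have hC : 0 < Cstar n m := by unfold Cstar; positivity
  have hCe : Cstar n m = 2 * m / (1 - m) * ((n : ℝ) - 2 - n * m) := by unfold Cstar; ring
  have hk : 0 < 2 * m / (1 - m) := by positivity
  have hp : 1 < 1 / m := by rwa [lt_div_iff₀ hm0, one_mul]
  have hd : 0 < ((n : ℝ) - 2 - n * m) / (1 - m) := by positivity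
  have hW := hf.isLogProfile hm0 hm1 hα hC
  have hW0 := hf.tendsto_logPressure_atBot hm0 hm1 (Cstar n m)
  have hW1 := hf.tendsto_logPressure_atTop hm0 hm1 hC
  have hbot := ((hf.tendsto_logPressureDeriv_atBot hm0 hm1 (Cstar n m)).sub ((hW0.sub
    (hW0.rpow_const (p := 1 / m) (Or.inr (by positivity)))).const_mul (2 * m / (1 - m)))).mul
      (Real.tendsto_exp_atBot.comp (tendsto_id.const_mul_atBot hd))
  rw [mul_zero] at hbot
  obtain ⟨B, hB, hgt, hlim⟩ := hW.tendsto_weighted (γ := gamma1 n m β) (γ' := gamma2 n m β) hp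
    (by field_simp) hd
    (by rw [hCe, mul_assoc, sub_pos]; exact mul_lt_of_lt_one_right hk (by linarith))
    (sub_lt_self _ (mul_pos hC hβ))
    (by rw [hsum, hCe]; unfold A0; field_simp; ring)
    hprod
    (by
      have h1 := mul_le_mul_of_nonneg_left hγ hC.le
      rw [hCe] at h1 ⊢
      calc _ = 2 * m / (1 - m) * ((n : ℝ) - 2 - n * m) * (1 / (1 - m)) := by ring
        _ ≤ _ := h1
        _ = _ := by ring)
    hlt hγ2 hW1 hW0 (hf.logPressureDeriv_pos_atBot hm0 hm1 hC) hbot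
  have hslope : Tendsto (fun s => slope (fun x : ℝ => x ^ (1 / m)) 1 (logPressure m (Cstar n m) f s))
      atTop (𝓝 (1 / m)) := by
    have h1 := hasDerivAt_iff_tendsto_slope.1
      (hasDerivAt_rpow_const (x := 1) (p := 1 / m) (Or.inl one_ne_zero))
    rw [one_rpow, mul_one] at h1
    exact h1.comp (tendsto_nhdsWithin_iff.2 ⟨hW1, hgt.mono fun s hs => hs.ne'⟩)
  refine ⟨1 / m * B, by positivity, ((hslope.mul hlim).comp tendsto_log_atTop).congr' ?_⟩
  filter_upwards [tendsto_log_atTop.eventually hgt, eventually_gt_atTop 0] with r hr hr0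
  have h1 := logPressure_rpow hm0 hm1 hC (hf.pos _ (exp_pos (log r)).le)
  simp only [Function.comp_apply, slope_def_field, one_rpow]
  rw [h1, exp_log hr0, rpow_def_of_pos hr0, mul_comm (log r)]
  have := (sub_pos.2 hr).ne'
  field_simp

end IsProfile

/-- Second-order asymptotics of the self-similar profile at infinity, case (C2). -/
theorem second_order_asymptotics_C2 (n : ℕ) (m β α : ℝ) (hn : 3 ≤ n) (hm0 : 0 < m)
    (hm1 : m < ((n : ℝ) - 2) / n) (hα : α = (2 * β + 1) / (1 - m)) (hC2 : CondC2 n m β)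
    (f : ℝ → ℝ → ℝ) (hf : ∀ lam, 0 < lam → IsProfile n m β α lam (f lam))
    (hscale : ∀ lam, 0 < lam → ∀ r, 0 ≤ r → f lam r = lam ^ (2 / (1 - m)) * f 1 (lam * r)) :
    ∃ B : ℝ, 0 < B ∧ ∀ lam, 0 < lam →
      Tendsto
        (fun r : ℝ => r ^ gamma1 n m β * ((r ^ 2 / Cstar n m) ^ (1 / (1 - m)) * f lam r - 1))
        atTop (nhds (B * lam ^ (-gamma1 n m β))) := by
  obtain ⟨B, hB, hlim⟩ := (hf 1 one_pos).exists_tendsto_weighted hn hm0 hm1 hα hC2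
  have hn0 : (0 : ℝ) < n := by exact_mod_cast (by lia : 0 < n)
  rw [lt_div_iff₀ hn0] at hm1
  have hC : 0 < Cstar n m := by
    unfold Cstar
    exact div_pos (mul_pos (by linarith) (by linarith)) (by nlinarith)
  refine ⟨B, hB, fun lam hlam => ?_⟩
  refine ((hlim.comp (tendsto_id.const_mul_atTop hlam)).mul_const
    (lam ^ (-gamma1 n m β))).congr' ?_
  filter_upwards [eventually_gt_atTop 0] with r hr
  simp only [Function.comp_apply, id]
  rw [hscale lam hlam r hr.le, mul_rpow hlam.le hr.le, rpow_neg hlam.le, mul_pow, mul_div_assoc,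
    mul_rpow (by positivity) (by positivity), ← rpow_natCast lam, ← rpow_mul hlam.le,
    Nat.cast_ofNat, mul_one_div]
  have := (rpow_pos_of_pos hlam (gamma1 n m β)).ne'
  field_simp
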